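/- Let m+1 be the minimal period length of the continued fraction expansion of √(D/Q). Then positive integers r, s satisfy r² − s²·D₂ = ±1 (D₂ = DQ) if and only if there is a natural number l such that, with k = l(m+1) − 1, one has r = r_k and s·Q = s_k. In other words, the units > 1 of ℤ[√D₂] correspond exactly to the convergents of √(D/Q) occurring just before the end of each period. -/

import Mathlib

/-- The sequence of complete quotients of `x`: `cq x 0 = x`,
`cq x (j+1) = 1 / (cq x j - ⌊cq x j⌋)`. -/
noncomputable def cq (x : ℝ) : ℕ → ℝ
  | 0 => x
  | j + 1 => (Int.fract (cq x j))⁻¹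

/-- The `j`-th partial quotient of the continued fraction expansion of `x`:
the floor of the `j`-th complete quotient. -/
noncomputable def pq (x : ℝ) (j : ℕ) : ℤ := ⌊cq x j⌋

theorem cq_cq (x : ℝ) (i j : ℕ) : cq (cq x i) j = cq x (i + j) := by
  induction j with
  | zero => rfl
  | succ j ih => rw [← add_assoc, cq, cq, ih]

theorem cq_one_add (x : ℝ) (j : ℕ) : cq (Int.fract x)⁻¹ j = cq x (j + 1) := by
  rw [add_comm j 1, ← cq_cq]
  rfl

theorem one_lt_inv_fract {x : ℝ} (hx : Irrational x) : 1 < (Int.fract x)⁻¹ := by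
  have h : 0 < Int.fract x := Int.fract_pos.2 (hx.ne_int _)
  exact (one_lt_inv₀ h).2 (Int.fract_lt_one x)

theorem irrational_inv_fract {x : ℝ} (hx : Irrational x) : Irrational (Int.fract x)⁻¹ :=
  (hx.sub_intCast ⌊x⌋).inv

theorem irrational_cq {x : ℝ} (hx : Irrational x) (n : ℕ) : Irrational (cq x n) := by
  induction n with
  | zero => exact hx
  | succ n ih => exact irrational_inv_fract ih

/-- A real number `x > 1` is a unimodular fractional linear transform of each of its complete
quotients, and the first column of the matrix is the corresponding convergent. -/
theorem exists_matrix_cq (n : ℕ) : ∀ {x : ℝ}, Irrational x → 1 < x →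
    ∃ P R S T : ℤ, 0 < P ∧ 0 ≤ R ∧ 0 < S ∧ 0 ≤ T ∧ (P * T - R * S = 1 ∨ P * T - R * S = -1) ∧
      x * (S * cq x (n + 1) + T) = P * cq x (n + 1) + R ∧ x.convergent n = (P : ℚ) / S := by
  induction n with
  | zero =>
    intro x hx h1
    have hfl : 0 < ⌊x⌋ := Int.floor_pos.2 h1.le
    have hf : Int.fract x ≠ 0 := (Int.fract_pos.2 (hx.ne_int _)).ne'
    refine ⟨⌊x⌋, 1, 1, 0, hfl, by norm_num, by norm_num, le_rfl, by simp, ?_, by simp⟩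
    have hx' : x = ⌊x⌋ + Int.fract x := (Int.floor_add_fract x).symm
    simp only [cq, Int.cast_one, Int.cast_zero]
    field_simp
    linarith
  | succ n ih =>
    intro x hx h1
    have hfl : 0 < ⌊x⌋ := Int.floor_pos.2 h1.le
    have hf : Int.fract x ≠ 0 := (Int.fract_pos.2 (hx.ne_int _)).ne'
    obtain ⟨P, R, S, T, hP, hR, hS, hT, hdet, heq, hconv⟩ :=
      ih (irrational_inv_fract hx) (one_lt_inv_fract hx)
    rw [cq_one_add] at heq
    refine ⟨⌊x⌋ * P + S, ⌊x⌋ * R + T, P, R, by positivity, by positivity, hP, hR, ?_, ?_, ?_⟩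
    · rw [show (⌊x⌋ * P + S) * R - (⌊x⌋ * R + T) * P = -(P * T - R * S) by ring]
      omega
    · have hx' : x = ⌊x⌋ + Int.fract x := (Int.floor_add_fract x).symm
      have h2 : S * cq x (n + 1 + 1) + T = Int.fract x * (P * cq x (n + 1 + 1) + R) := by
        rw [← heq]
        field_simp
      push_cast
      linear_combination (P * cq x (n + 1 + 1) + R) * hx' - h2
    · rw [Real.convergent_succ, hconv]
      have hP' : (P : ℚ) ≠ 0 := by exact_mod_cast hP.ne'
      have hS' : (S : ℚ) ≠ 0 := by exact_mod_cast hS.ne'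
      push_cast
      field_simp

theorem convergent_congr (n : ℕ) : ∀ {x y : ℝ}, (∀ j, pq x j = pq y j) →
    x.convergent n = y.convergent n := by
  induction n with
  | zero =>
    intro x y h
    exact congrArg (Int.cast : ℤ → ℚ) (h 0)
  | succ n ih =>
    intro x y h
    have h0 : ⌊x⌋ = ⌊y⌋ := h 0
    rw [Real.convergent_succ, Real.convergent_succ, h0,
      ih (x := (Int.fract x)⁻¹) (y := (Int.fract y)⁻¹)]
    intro j
    simp only [pq, cq_one_add]
    exact h (j + 1)

theorem eq_of_pq_eq {x y : ℝ} (h : ∀ j, pq x j = pq y j) : x = y := by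
  have hconvs : (GenContFract.of x).convs = (GenContFract.of y).convs := by
    funext n
    rw [Real.convs_eq_convergent, Real.convs_eq_convergent, convergent_congr n h]
  exact tendsto_nhds_unique (GenContFract.of_convergence x) (hconvs ▸ GenContFract.of_convergence y)

theorem cq_periodic_of_pq_periodic {x : ℝ} {d : ℕ} (h : ∀ j, 1 ≤ j → pq x (j + d) = pq x j)
    {j : ℕ} (hj : 1 ≤ j) : cq x (j + d) = cq x j := by
  refine eq_of_pq_eq fun i => ?_
  have := h (j + i) (by omega)
  simpa only [pq, cq_cq, add_right_comm] using this

theorem pq_periodic_of_cq_eq {x : ℝ} {d : ℕ} (h : cq x (1 + d) = cq x 1) {j : ℕ} (hj : 1 ≤ j) :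
    pq x (j + d) = pq x j := by
  obtain ⟨i, rfl⟩ := Nat.exists_eq_add_of_le hj
  rw [pq, pq, add_right_comm, ← cq_cq, h, cq_cq]

theorem periodic_mul {α : Type*} {f : ℕ → α} {d : ℕ} (h : ∀ j, 1 ≤ j → f (j + d) = f j) (l : ℕ)
    {j : ℕ} (hj : 1 ≤ j) : f (j + l * d) = f j := by
  induction l with
  | zero => simp
  | succ l ih => rw [Nat.succ_mul, ← add_assoc, h _ (by omega), ih]

theorem dvd_of_minimal_period {α : Type*} {f : ℕ → α} {m d : ℕ}
    (hper : ∀ j, 1 ≤ j → f (j + (m + 1)) = f j)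
    (hmin : ∀ m', m' < m → ¬ ∀ j, 1 ≤ j → f (j + m' + 1) = f j)
    (hd : ∀ j, 1 ≤ j → f (j + d) = f j) : m + 1 ∣ d := by
  by_contra hnd
  have hpos : 0 < d % (m + 1) := Nat.pos_of_ne_zero fun h => hnd (Nat.dvd_of_mod_eq_zero h)
  have hlt : d % (m + 1) < m + 1 := Nat.mod_lt _ m.succ_pos
  refine hmin (d % (m + 1) - 1) (by omega) fun j hj => ?_
  rw [← hd j hj, ← periodic_mul hper (d / (m + 1)) (by omega)]
  congr 1
  have := Nat.mod_add_div d (m + 1)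
  rw [mul_comm] at this
  omega

/-- If the complete quotient after the convergent `P / S` of a quadratic surd `x` differs from
`x` by an integer, then `P ^ 2 - S ^ 2 * x ^ 2` is the determinant of the transformation. -/
theorem norm_eq_det {x : ℝ} (hx : Irrational x) {a : ℚ} (ha : x ^ 2 = a) {P R S T c : ℤ}
    (h : x * (S * (x + c) + T) = P * (x + c) + R) :
    (P : ℝ) ^ 2 - S ^ 2 * x ^ 2 = P * T - R * S := by
  have hlin : ((S * c + T - P : ℤ) : ℝ) * x = ((P * c + R - S * a : ℚ) : ℝ) := by
    push_cast
    linear_combination h - S * ha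
  have h0 : (S * c + T - P : ℤ) = 0 := by
    by_contra hne
    exact (hx.intCast_mul hne).ne_rat _ hlin
  have h1 : (S : ℝ) * c + T - P = 0 := by exact_mod_cast h0
  linear_combination -S * h - (P - S * x) * h1

/-- A convergent `P / S` of `x` with `P ^ 2 - S ^ 2 * x ^ 2 = ±1` and `S * x ^ 2` an integer `N`
is followed by a complete quotient which differs from `x` by an integer. -/
theorem exists_eq_add_int {x y : ℝ} (hx : 0 < x) (hy : 0 < y) {P R S T N : ℤ} (hP : 0 < P)
    (hS : 0 < S) (hT : 0 ≤ T) (hN : S * x ^ 2 = N)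
    (hnorm : P ^ 2 - N * S = 1 ∨ P ^ 2 - N * S = -1)
    (hdet : P * T - R * S = 1 ∨ P * T - R * S = -1)
    (h : x * (S * y + T) = P * y + R) : ∃ c : ℤ, y = x + c := by
  have hP' : (0 : ℝ) < P := by exact_mod_cast hP
  have hS' : (0 : ℝ) < S := by exact_mod_cast hS
  have hT' : (0 : ℝ) ≤ T := by exact_mod_cast hT
  have h1 : (P - S * x) * (S * y + T) = ((P * T - R * S : ℤ) : ℝ) := by
    push_cast
    linear_combination -S * h
  have h2 : (P - S * x) * (P + S * x) = ((P ^ 2 - N * S : ℤ) : ℝ) := by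
    push_cast
    linear_combination -S * hN
  have hpos1 : 0 < S * y + T := by positivity
  have hpos2 : 0 < P + S * x := by positivity
  have hne : P - S * x ≠ 0 := by
    intro h0
    rw [h0, zero_mul] at h2
    have : P ^ 2 - N * S = 0 := by exact_mod_cast h2.symm
    omega
  have hsign : P * T - R * S = P ^ 2 - N * S := by
    rcases lt_or_gt_of_ne hne with hlt | hgt
    · have a1 := mul_neg_of_neg_of_pos hlt hpos1
      have a2 := mul_neg_of_neg_of_pos hlt hpos2
      rw [h1] at a1
      rw [h2] at a2
      have b1 : P * T - R * S < 0 := by exact_mod_cast a1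
      have b2 : P ^ 2 - N * S < 0 := by exact_mod_cast a2
      omega
    · have a1 := mul_pos hgt hpos1
      have a2 := mul_pos hgt hpos2
      rw [h1] at a1
      rw [h2] at a2
      have b1 : 0 < P * T - R * S := by exact_mod_cast a1
      have b2 : 0 < P ^ 2 - N * S := by exact_mod_cast a2
      omega
  have hcop : IsCoprime S P := by
    rcases hdet with hd | hd
    · exact ⟨-R, T, by linear_combination hd⟩
    · exact ⟨R, -T, by linear_combination -hd⟩
  obtain ⟨c, hc⟩ : S ∣ P - T :=
    hcop.dvd_of_dvd_mul_left ⟨N - R, by linear_combination -hsign⟩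
  have hR : R = N - P * c :=
    mul_right_cancel₀ hS.ne' (by linear_combination -hsign - P * hc)
  refine ⟨c, mul_left_cancel₀ hne ?_⟩
  have hRr : (R : ℝ) = N - P * c := by exact_mod_cast hR
  have hcr : (P : ℝ) - T = S * c := by exact_mod_cast hc
  linear_combination -h - hRr + hN - x * hcr

/-- Positive coprime solutions of `p ^ 2 - q ^ 2 * x ^ 2 = ±1` with `q ≤ p` are convergents. -/
theorem exists_convergent_eq {x : ℝ} (hx : 1 < x) {p q : ℕ} (hq : 0 < q) (hqp : q ≤ p)
    (hcop : Nat.Coprime p q) (h : |(p : ℝ) ^ 2 - q ^ 2 * x ^ 2| = 1) :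
    ∃ n, x.convergent n = (p : ℚ) / q := by
  have hden : ((p : ℚ) / q).den = q := by
    have := Rat.den_div_eq_of_coprime (a := p) (b := q) (by exact_mod_cast hq) (by simpa using hcop)
    simpa only [Int.cast_natCast, Nat.cast_inj] using this
  have hq' : (0 : ℝ) < q := by exact_mod_cast hq
  have hqp' : (q : ℝ) ≤ p := by exact_mod_cast hqp
  have hlt : |x - ((p : ℚ) / q : ℚ)| < 1 / (2 * (((p : ℚ) / q).den : ℝ) ^ 2) := by
    rw [hden]
    push_cast
    have hsum : 2 * q < p + q * x := by nlinarith
    have hpos : 0 < p + q * x := by linarith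
    have key : |x - p / q| * (q * (p + q * x)) = 1 := by
      rw [← h, ← abs_of_pos (show 0 < q * (p + q * x) by positivity), ← abs_mul,
        abs_sub_comm ((p : ℝ) ^ 2)]
      congr 1
      field_simp
      ring
    rw [eq_div_of_mul_eq (by positivity) key]
    apply one_div_lt_one_div_of_lt (by positivity)
    nlinarith
  obtain ⟨n, hn⟩ := Real.exists_rat_eq_convergent hlt
  exact ⟨n, hn.symm⟩

theorem num_den_eq_of_det {P R S T : ℤ} (hS : 0 < S)
    (hdet : P * T - R * S = 1 ∨ P * T - R * S = -1) {p q : ℕ} (hq : 0 < q)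
    (hcop : Nat.Coprime p q) (h : (P : ℚ) / S = (p : ℚ) / q) : P = p ∧ S = q := by
  have hPS : IsCoprime P S := by
    rcases hdet with hd | hd
    · exact ⟨T, -R, by linear_combination hd⟩
    · exact ⟨-T, R, by linear_combination -hd⟩
  have h' : (P : ℚ) / S = ((p : ℤ) : ℚ) / ((q : ℤ) : ℚ) := by
    simpa only [Int.cast_natCast] using h
  exact Rat.div_int_inj hS (by exact_mod_cast hq) (Int.isCoprime_iff_nat_coprime.1 hPS)
    (by simpa using hcop) h'

theorem irrational_sqrt_div {D Q : ℕ} (hns : ¬ ∃ a : ℚ, a ^ 2 = (D : ℚ) / Q) :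
    Irrational (Real.sqrt ((D : ℝ) / Q)) := by
  rintro ⟨a, ha⟩
  refine hns ⟨a, ?_⟩
  have : (a : ℝ) ^ 2 = D / Q := by rw [ha, Real.sq_sqrt (by positivity)]
  apply Rat.cast_injective (α := ℝ)
  simpa using this

/-- Let `m+1` be the minimal period length of the continued fraction expansion of
`√(D/Q)`. Then positive integers `r, s` satisfy `r² − s²·D₂ = ±1` (`D₂ = DQ`) if and
only if there is `l ≥ 1` such that, with `k = l(m+1) − 1`, one has `r = r_k` and
`s·Q = s_k`. -/
theorem stmt_9 (D Q : ℕ) (hD : 0 < D) (hQ : 0 < Q) (hQD : Q < D)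
    (hcop : Nat.Coprime D Q)
    (hns : ¬ ∃ a : ℚ, a ^ 2 = (D : ℚ) / Q)
    (m : ℕ)
    (hper : ∀ j : ℕ, 1 ≤ j →
      pq (Real.sqrt ((D : ℝ) / (Q : ℝ))) (j + m + 1) = pq (Real.sqrt ((D : ℝ) / (Q : ℝ))) j)
    (hper0 : pq (Real.sqrt ((D : ℝ) / (Q : ℝ))) (m + 1)
      = 2 * pq (Real.sqrt ((D : ℝ) / (Q : ℝ))) 0)
    (hmin : ∀ m' : ℕ, m' < m → ¬ (∀ j : ℕ, 1 ≤ j →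
      pq (Real.sqrt ((D : ℝ) / (Q : ℝ))) (j + m' + 1) = pq (Real.sqrt ((D : ℝ) / (Q : ℝ))) j))
    (r s : ℕ) (hr : 0 < r) (hs : 0 < s) :
    ((r : ℤ) ^ 2 - (s : ℤ) ^ 2 * ((D : ℤ) * (Q : ℤ)) = 1 ∨
     (r : ℤ) ^ 2 - (s : ℤ) ^ 2 * ((D : ℤ) * (Q : ℤ)) = -1) ↔
    ∃ l : ℕ, 0 < l ∧ Nat.Coprime r (s * Q) ∧
      (GenContFract.of (Real.sqrt ((D : ℝ) / (Q : ℝ)))).convs (l * (m + 1) - 1)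
        = (r : ℝ) / ((s * Q : ℕ) : ℝ) := by
  have hirr := irrational_sqrt_div hns
  have hQ' : (0 : ℝ) < Q := by exact_mod_cast hQ
  have h1 : 1 < Real.sqrt ((D : ℝ) / Q) := by
    rw [Real.lt_sqrt (by norm_num), one_pow, one_lt_div hQ']
    exact_mod_cast hQD
  have hsq : Real.sqrt ((D : ℝ) / Q) ^ 2 = D / Q := Real.sq_sqrt (by positivity)
  generalize Real.sqrt ((D : ℝ) / Q) = x at *
  have hsQ : 0 < s * Q := Nat.mul_pos hs hQ
  have hnorm : (r : ℝ) ^ 2 - ((s * Q : ℕ) : ℝ) ^ 2 * x ^ 2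
      = (((r : ℤ) ^ 2 - (s : ℤ) ^ 2 * ((D : ℤ) * (Q : ℤ)) : ℤ) : ℝ) := by
    rw [hsq]
    push_cast
    field_simp
  constructor
  · intro h
    have hcop' : Nat.Coprime r (s * Q) := by
      rw [← Nat.isCoprime_iff_coprime]
      push_cast
      rcases h with h | h
      · exact ⟨r, -(s * D), by linear_combination h⟩
      · exact ⟨-r, s * D, by linear_combination -h⟩
    have hqp : s * Q ≤ r := by
      have hDQ : (Q : ℤ) + 1 ≤ D := by exact_mod_cast hQD
      have hs' : (1 : ℤ) ≤ s := by exact_mod_cast hs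
      have hQ1 : (1 : ℤ) ≤ Q := by exact_mod_cast hQ
      have hsQ1 : (1 : ℤ) ≤ s ^ 2 * Q := by
        have : (0 : ℤ) < s ^ 2 * Q := by positivity
        omega
      have hmul := mul_le_mul_of_nonneg_left hDQ (show (0 : ℤ) ≤ s ^ 2 * Q by positivity)
      have : ((s * Q : ℕ) : ℤ) ^ 2 ≤ (r : ℤ) ^ 2 := by
        push_cast
        rcases h with h | h <;> nlinarith
      exact_mod_cast abs_le_of_sq_le_sq' this (by positivity) |>.2
    obtain ⟨n, hn⟩ := exists_convergent_eq h1 hsQ hqp hcop' (by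
      rw [hnorm]
      rcases h with h | h <;> simp [h])
    obtain ⟨P, R, S, T, hP, -, hS, hT, hdet, heq, hconv⟩ := exists_matrix_cq n hirr h1
    obtain ⟨rfl, rfl⟩ := num_den_eq_of_det hS hdet hsQ hcop' (hconv.symm.trans hn)
    have hy : 0 < cq x (n + 1) :=
      zero_lt_one.trans (one_lt_inv_fract (irrational_cq hirr n))
    obtain ⟨c, hc⟩ := exists_eq_add_int (N := s * D) (zero_lt_one.trans h1) hy hP hS hT
      (by rw [hsq]; push_cast; field_simp)
      (by
        rw [show (r : ℤ) ^ 2 - s * D * ((s * Q : ℕ) : ℤ) = (r : ℤ) ^ 2 - s ^ 2 * (D * Q) by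
          push_cast; ring]
        exact h) hdet heq
    have hcq : cq x (1 + (n + 1)) = cq x 1 := by
      rw [add_comm 1, cq, hc, Int.fract_add_intCast]
      rfl
    obtain ⟨l, hl⟩ := dvd_of_minimal_period hper hmin fun j hj => pq_periodic_of_cq_eq hcq hj
    refine ⟨l, Nat.pos_of_ne_zero ?_, hcop', ?_⟩
    · rintro rfl
      simp at hl
    · rw [mul_comm l, ← hl, Nat.add_sub_cancel, Real.convs_eq_convergent, hn]
      push_cast
      rfl
  · rintro ⟨l, hl, hcop', hconvs⟩
    obtain ⟨k, hk⟩ : ∃ k, l * (m + 1) = k + 1 :=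
      Nat.exists_eq_succ_of_ne_zero (Nat.mul_pos hl m.succ_pos).ne'
    rw [hk, Nat.add_sub_cancel, Real.convs_eq_convergent] at hconvs
    obtain ⟨P, R, S, T, -, -, hS, -, hdet, heq, hconv⟩ := exists_matrix_cq k hirr h1
    have hn : x.convergent k = (r : ℚ) / ((s * Q : ℕ) : ℚ) := by
      apply Rat.cast_injective (α := ℝ)
      simpa using hconvs
    obtain ⟨rfl, rfl⟩ := num_den_eq_of_det hS hdet hsQ hcop' (hconv.symm.trans hn)
    have hcq : cq x (1 + l * (m + 1)) = cq x 1 :=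
      cq_periodic_of_pq_periodic (fun _ hj => periodic_mul hper l hj) le_rfl
    rw [hk, add_comm] at hcq
    replace hcq : Int.fract (cq x (k + 1)) = Int.fract x := inv_injective hcq
    rw [Int.fract_eq_fract] at hcq
    obtain ⟨c, hc⟩ := hcq
    rw [show cq x (k + 1) = x + c by rw [← hc]; ring] at heq
    have hN := norm_eq_det hirr (a := D / Q) (by push_cast; exact hsq) heq
    rw [Int.cast_natCast, Int.cast_natCast, hnorm] at hN
    have hN' : (r : ℤ) ^ 2 - (s : ℤ) ^ 2 * ((D : ℤ) * (Q : ℤ)) = r * T - R * (s * Q : ℕ) := by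
      exact_mod_cast hN
    rw [hN']
    exact hdet
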